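/- arXiv:1212.5106 — 2 statements merged into one kernel-verified Lean document; each statement's English description precedes it below -/
import Mathlib

section
/- An infinite word ω over alphabet A = {1,2,3} whose set of factors is closed under the Arnoux-Rauzy S-adic generation with directive sequence (i_m) satisfying: the directive sequence never contains h+1 consecutive equal letters (i.e., for no m does i_m = i_{m+1} = ⋯ = i_{m+h} hold), is (2h+1)-balanced: for all factors u, v of ω with |u| = |v| and all letters j, we have ||u|_j − |v|_j| ≤ 2h+1. -/
/-- The Arnoux-Rauzy substitution `σ_i : i ↦ i, j ↦ j i` for `j ≠ i`,
extended to words. Letters 1,2,3 are represented by `0,1,2 : Fin 3`. -/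
def sigmaSub {A : Type*} [DecidableEq A] (i : A) (w : List A) : List A :=
  w.flatMap fun j => if j = i then [i] else [j, i]

/-- `ARword dir n = σ_{i₀} σ_{i₁} ⋯ σ_{i_{n-1}} (1)` for the directive
sequence `dir`, where the letter `1` is represented by `0 : Fin 3`. -/
def ARword (dir : ℕ → Fin 3) (n : ℕ) : List (Fin 3) :=
  ((List.range n).map dir).foldr sigmaSub [0]

/-- `u` is a factor of the infinite word `ω`. -/
def FactorOf {A : Type*} (ω : ℕ → A) (u : List A) : Prop :=
  ∃ k, u = (List.range u.length).map fun t => ω (k + t)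

/-- `ω` is an Arnoux-Rauzy word with directive sequence `dir`: every letter
occurs infinitely often in `dir`, and the factors of `ω` are exactly the
factors of the words `σ_{i₀} ⋯ σ_{i_{n-1}}(1)`. -/
def IsAR (ω : ℕ → Fin 3) (dir : ℕ → Fin 3) : Prop :=
  (∀ a : Fin 3, ∀ m : ℕ, ∃ n, m ≤ n ∧ dir n = a) ∧
  (∀ u : List (Fin 3), FactorOf ω u ↔ ∃ n, u <:+: ARword dir n)

/-- `ω` is `C`-balanced: any two factors of equal length have all letter-count
differences bounded by `C` in absolute value. -/
def IsBalanced {A : Type*} [DecidableEq A] (C : ℕ) (ω : ℕ → A) : Prop :=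
  ∀ u v : List A, FactorOf ω u → FactorOf ω v → u.length = v.length →
    ∀ j : A, |(u.count j : ℤ) - v.count j| ≤ C

/-- Core invariant on difference vectors `(A, X, B)`, with run counters `ra`, `rx`. -/
def ARCore (K A X B ra rx : ℤ) : Prop :=
  (K ≤ A ∧ B ≤ -K) ∨
  (X = K - 1 ∧ B = -K ∧ A ≤ K - 1 ∧ K - 2 - ra ≤ A) ∨
  (X = K - 1 ∧ 1 ≤ A ∧ A ≤ K - 1 ∧ B ≤ -2 * K - A + 3) ∨
  (B ≤ -(2 * K - 4) ∧ K - 3 ≤ A ∧ K - 3 ≤ X ∧ 2 * K - 4 ≤ A + X) ∨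
  (B ≤ -(2 * K - 4) ∧ K - 4 ≤ X ∧ K - 1 ≤ A ∧ (B ≤ -(2 * K - 3) ∨ 1 ≤ rx))

theorem ARCore_stepA (h A X B ra rx c A' : ℤ) (hh : 1 ≤ h) (h1 : 0 ≤ ra)
    (h3 : ra + 1 ≤ h) (hc : -2 ≤ c) (hc' : c ≤ 2) (hA : A = A' + X + B + c)
    (H : ARCore (h + 3) A X B ra rx) :
    ARCore (h + 3) A' X B (ra + 1) 0 ∨ ARCore (h + 3) X A' B 0 (ra + 1) := by
  unfold ARCore at *
  rcases H with H | H | H | H | H <;>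
  rcases lt_or_ge X (h + 2) with g0 | g0 <;>
  rcases lt_or_ge X (h + 3) with g1 | g1 <;>
  rcases lt_or_ge A' (h + 3) with g2 | g2 <;>
  first
    | exact Or.inl (Or.inl (by omega))
    | exact Or.inl (Or.inr (Or.inl (by omega)))
    | exact Or.inl (Or.inr (Or.inr (Or.inl (by omega))))
    | exact Or.inl (Or.inr (Or.inr (Or.inr (Or.inl (by omega)))))
    | exact Or.inl (Or.inr (Or.inr (Or.inr (Or.inr (by omega)))))
    | exact Or.inr (Or.inl (by omega))
    | exact Or.inr (Or.inr (Or.inl (by omega)))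
    | exact Or.inr (Or.inr (Or.inr (Or.inl (by omega))))
    | exact Or.inr (Or.inr (Or.inr (Or.inr (Or.inl (by omega)))))
    | exact Or.inr (Or.inr (Or.inr (Or.inr (Or.inr (by omega)))))

theorem ARCore_stepX (h A X B ra rx c X' : ℤ) (hh : 1 ≤ h) (h1 : 0 ≤ ra) (h2 : 0 ≤ rx)
    (h3 : rx + 1 ≤ h) (hr : ra ≤ h) (hc : -2 ≤ c) (hc' : c ≤ 2) (hA : X = A + X' + B + c)
    (H : ARCore (h + 3) A X B ra rx) :
    ARCore (h + 3) A X' B 0 (rx + 1) ∨ ARCore (h + 3) X' A B (rx + 1) 0 := by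
  unfold ARCore at *
  rcases H with H | H | H | H | H <;>
  rcases lt_or_ge A (h + 2) with g0 | g0 <;>
  rcases lt_or_ge X' (h + 2) with g1 | g1 <;>
  rcases lt_or_ge A (h + 3) with g2 | g2 <;>
  rcases lt_or_ge X' (h + 3) with g3 | g3 <;>
  first
    | exact Or.inl (Or.inl (by omega))
    | exact Or.inl (Or.inr (Or.inl (by omega)))
    | exact Or.inl (Or.inr (Or.inr (Or.inl (by omega))))
    | exact Or.inl (Or.inr (Or.inr (Or.inr (Or.inl (by omega)))))
    | exact Or.inl (Or.inr (Or.inr (Or.inr (Or.inr (by omega)))))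
    | exact Or.inr (Or.inl (by omega))
    | exact Or.inr (Or.inr (Or.inl (by omega)))
    | exact Or.inr (Or.inr (Or.inr (Or.inl (by omega))))
    | exact Or.inr (Or.inr (Or.inr (Or.inr (Or.inl (by omega)))))
    | exact Or.inr (Or.inr (Or.inr (Or.inr (Or.inr (by omega)))))

theorem ARCore_stepB (h A X B ra rx rb c B' : ℤ) (hh : 1 ≤ h) (h1 : 0 ≤ ra) (h2 : 0 ≤ rb)
    (h3 : rb + 1 ≤ h) (hr : ra ≤ h) (hc : -2 ≤ c) (hc' : c ≤ 2) (hA : B = A + X + B' + c)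
    (H : ARCore (h + 3) A X B ra rx) :
    ARCore (h + 3) A X B' 0 0 ∨ ARCore (h + 3) A B' X 0 (rb + 1) ∨
    ARCore (h + 3) (-B') (-X) (-A) (rb + 1) 0 ∨ ARCore (h + 3) (-X) (-B') (-A) 0 (rb + 1) := by
  unfold ARCore at *
  rcases H with H | H | H | H | H <;>
  rcases lt_or_ge (-(h+3)) X with g0 | g0 <;>
  rcases lt_or_ge (-(h+3)) B' with g1 | g1 <;>
  first
    | exact Or.inl (Or.inl (by omega))
    | exact Or.inl (Or.inr (Or.inl (by omega)))
    | exact Or.inl (Or.inr (Or.inr (Or.inl (by omega))))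
    | exact Or.inl (Or.inr (Or.inr (Or.inr (Or.inl (by omega)))))
    | exact Or.inl (Or.inr (Or.inr (Or.inr (Or.inr (by omega)))))
    | exact Or.inr (Or.inl (Or.inl (by omega)))
    | exact Or.inr (Or.inl (Or.inr (Or.inl (by omega))))
    | exact Or.inr (Or.inl (Or.inr (Or.inr (Or.inl (by omega)))))
    | exact Or.inr (Or.inl (Or.inr (Or.inr (Or.inr (Or.inl (by omega))))))
    | exact Or.inr (Or.inl (Or.inr (Or.inr (Or.inr (Or.inr (by omega))))))
    | exact Or.inr (Or.inr (Or.inl (Or.inl (by omega))))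
    | exact Or.inr (Or.inr (Or.inl (Or.inr (Or.inl (by omega)))))
    | exact Or.inr (Or.inr (Or.inl (Or.inr (Or.inr (Or.inl (by omega))))))
    | exact Or.inr (Or.inr (Or.inl (Or.inr (Or.inr (Or.inr (Or.inl (by omega)))))))
    | exact Or.inr (Or.inr (Or.inl (Or.inr (Or.inr (Or.inr (Or.inr (by omega)))))))

/-- The invariant, up to permutation and global sign. -/
def ARInv (h : ℕ) (d : Fin 3 → ℤ) (R : Fin 3 → ℕ) : Prop :=
  ∃ a x b : Fin 3, a ≠ x ∧ a ≠ b ∧ x ≠ b ∧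
    (ARCore (h + 3) (d a) (d x) (d b) (R a) (R x) ∨
     ARCore (h + 3) (-d a) (-d x) (-d b) (R a) (R x))

theorem AR_sum3 (d : Fin 3 → ℤ) {a x b : Fin 3} (h1 : a ≠ x) (h2 : a ≠ b) (h3 : x ≠ b) :
    ∑ j, d j = d a + d x + d b := by
  rw [Fin.sum_univ_three]
  fin_cases a <;> fin_cases x <;> fin_cases b <;> simp at * <;> ring

theorem ARInv_step (h : ℕ) (hh : 1 ≤ h) (d d' : Fin 3 → ℤ) (R R' : Fin 3 → ℕ) (i : Fin 3) (c : ℤ)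
    (hc : -2 ≤ c) (hc' : c ≤ 2) (hd : ∀ j, j ≠ i → d' j = d j) (hi : d i = ∑ j, d' j + c)
    (hR : ∀ j, R j ≤ h) (hRi : R i + 1 ≤ h) (hR' : R' i = R i + 1)
    (hR0 : ∀ j, j ≠ i → R' j = 0) (H : ARInv h d R) : ARInv h d' R' := by
  obtain ⟨a, x, b, hax, hab, hxb, H⟩ := H
  rw [AR_sum3 d' hax hab hxb] at hi
  have hRa := hR a
  have hRx := hR x
  have hcase : i = a ∨ i = x ∨ i = b := by
    fin_cases a <;> fin_cases x <;> fin_cases b <;> fin_cases i <;> simp at *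
  rcases hcase with rfl | rfl | rfl
  · have e1 := hd x hax.symm
    have e2 := hd b hab.symm
    have r1 := hR0 x hax.symm
    rcases H with H | H
    · rcases ARCore_stepA h _ _ _ _ _ c (d' i) (by omega) (by omega) (by omega) hc hc'
        (by omega) H with H | H
      · exact ⟨i, x, b, hax, hab, hxb, Or.inl (by simpa [e1, e2, r1, hR'] using H)⟩
      · exact ⟨x, i, b, hax.symm, hxb, hab, Or.inl (by simpa [e1, e2, r1, hR'] using H)⟩
    · rcases ARCore_stepA h _ _ _ _ _ (-c) (-d' i) (by omega) (by omega) (by omega)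
        (by omega) (by omega) (by omega) H with H | H
      · exact ⟨i, x, b, hax, hab, hxb, Or.inr (by simpa [e1, e2, r1, hR'] using H)⟩
      · exact ⟨x, i, b, hax.symm, hxb, hab, Or.inr (by simpa [e1, e2, r1, hR'] using H)⟩
  · have e1 := hd a hax
    have e2 := hd b hxb.symm
    have r1 := hR0 a hax
    rcases H with H | H
    · rcases ARCore_stepX h _ _ _ _ _ c (d' i) (by omega) (by omega) (by omega) (by omega)
        (by omega) hc hc' (by omega) H with H | H
      · exact ⟨a, i, b, hax, hab, hxb, Or.inl (by simpa [e1, e2, r1, hR'] using H)⟩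
      · exact ⟨i, a, b, hax.symm, hxb, hab, Or.inl (by simpa [e1, e2, r1, hR'] using H)⟩
    · rcases ARCore_stepX h _ _ _ _ _ (-c) (-d' i) (by omega) (by omega) (by omega) (by omega)
        (by omega) (by omega) (by omega) (by omega) H with H | H
      · exact ⟨a, i, b, hax, hab, hxb, Or.inr (by simpa [e1, e2, r1, hR'] using H)⟩
      · exact ⟨i, a, b, hax.symm, hxb, hab, Or.inr (by simpa [e1, e2, r1, hR'] using H)⟩
  · have e1 := hd a hab
    have e2 := hd x hxb
    have r1 := hR0 a hab
    have r2 := hR0 x hxb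
    rcases H with H | H
    · rcases ARCore_stepB h _ _ _ _ _ (R i) c (d' i) (by omega) (by omega) (by omega) (by omega)
        (by omega) hc hc' (by omega) H with H | H | H | H
      · exact ⟨a, x, i, hax, hab, hxb, Or.inl (by simpa [e1, e2, r1, r2, hR'] using H)⟩
      · exact ⟨a, i, x, hab, hax, hxb.symm, Or.inl (by simpa [e1, e2, r1, r2, hR'] using H)⟩
      · exact ⟨i, x, a, hxb.symm, hab.symm, hax.symm,
          Or.inr (by simpa [e1, e2, r1, r2, hR'] using H)⟩
      · exact ⟨x, i, a, hxb, hax.symm, hab.symm,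
          Or.inr (by simpa [e1, e2, r1, r2, hR'] using H)⟩
    · rcases ARCore_stepB h _ _ _ _ _ (R i) (-c) (-d' i) (by omega) (by omega) (by omega)
        (by omega) (by omega) (by omega) (by omega) (by omega) H with H | H | H | H
      · exact ⟨a, x, i, hax, hab, hxb, Or.inr (by simpa [e1, e2, r1, r2, hR'] using H)⟩
      · exact ⟨a, i, x, hab, hax, hxb.symm, Or.inr (by simpa [e1, e2, r1, r2, hR'] using H)⟩
      · exact ⟨i, x, a, hxb.symm, hab.symm, hax.symm,
          Or.inl (by simpa [e1, e2, r1, r2, hR'] using H)⟩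
      · exact ⟨x, i, a, hxb, hax.symm, hab.symm,
          Or.inl (by simpa [e1, e2, r1, r2, hR'] using H)⟩

theorem ARInv_small (h : ℕ) (hh : 1 ≤ h) (d : Fin 3 → ℤ) (R : Fin 3 → ℕ)
    (hd : ∀ j, -1 ≤ d j ∧ d j ≤ 1) : ¬ ARInv h d R := by
  rintro ⟨a, x, b, -, -, -, H⟩
  have := hd a
  have := hd x
  have := hd b
  unfold ARCore at H
  omega

theorem ARInv_init_aux (h : ℕ) (hh : 1 ≤ h) (A X B : ℤ) (hs : A + X + B = 0)
    (hB : B ≤ -(2 * h + 2)) (h1 : B ≤ -A) (h2 : B ≤ -X) (h3 : B ≤ A) (h4 : B ≤ X) :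
    ARCore (h + 3) A X B 0 0 ∨ ARCore (h + 3) X A B 0 0 := by
  unfold ARCore
  omega

theorem ARInv_init (h : ℕ) (hh : 1 ≤ h) (d : Fin 3 → ℤ) (hs : ∑ j, d j = 0) (j : Fin 3)
    (hj : 2 * (h : ℤ) + 1 < |d j|) : ARInv h d (fun _ => 0) := by
  obtain ⟨b, hb⟩ : ∃ b, ∀ k, |d k| ≤ |d b| := Finite.exists_max (fun k => |d k|)
  have hbig := lt_of_lt_of_le hj (hb j)
  obtain ⟨a, x, hax, hab, hxb⟩ : ∃ a x : Fin 3, a ≠ x ∧ a ≠ b ∧ x ≠ b := by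
    clear hb hbig
    revert b
    decide
  rw [AR_sum3 d hax hab hxb] at hs
  have ha := hb a
  have hx := hb x
  rcases le_or_gt 0 (d b) with hp | hp
  · rw [abs_of_nonneg hp] at *
    rw [abs_le] at ha hx
    rcases ARInv_init_aux h hh (-d a) (-d x) (-d b) (by omega) (by omega) (by omega) (by omega)
      (by omega) (by omega) with H | H
    · exact ⟨a, x, b, hax, hab, hxb, Or.inr (by simpa using H)⟩
    · exact ⟨x, a, b, hax.symm, hxb, hab, Or.inr (by simpa using H)⟩
  · rw [abs_of_neg hp] at *
    rw [abs_le] at ha hx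
    rcases ARInv_init_aux h hh (d a) (d x) (d b) (by omega) (by omega) (by omega) (by omega)
      (by omega) (by omega) with H | H
    · exact ⟨a, x, b, hax, hab, hxb, Or.inl (by simpa using H)⟩
    · exact ⟨x, a, b, hax.symm, hxb, hab, Or.inl (by simpa using H)⟩

theorem sigmaSub_cons (i a : Fin 3) (w : List (Fin 3)) :
    sigmaSub i (a :: w) = (if a = i then [i] else [a, i]) ++ sigmaSub i w := by
  simp [sigmaSub]

theorem sigmaSub_append (i : Fin 3) (w z : List (Fin 3)) :
    sigmaSub i (w ++ z) = sigmaSub i w ++ sigmaSub i z := by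
  simp [sigmaSub]

theorem desubPre_lemma (i : Fin 3) (w u : List (Fin 3)) (hu : u <+: sigmaSub i w) :
    ∃ u', u' <+: w ∧ (∀ j, j ≠ i → u.count j = u'.count j) ∧
      u.count i ≤ u'.length ∧ u'.length ≤ u.count i + 1 := by
  induction w generalizing u with
  | nil =>
    have : u = [] := by simpa [sigmaSub] using hu
    subst this
    exact ⟨[], by simp⟩
  | cons a w ih =>
    rw [sigmaSub_cons] at hu
    by_cases hai : a = i
    · subst hai
      rw [if_pos rfl, List.singleton_append, List.prefix_cons_iff] at hu
      rcases hu with rfl | ⟨t, rfl, ht⟩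
      · exact ⟨[], by simp⟩
      · obtain ⟨u', h1, h2, h3, h4⟩ := ih t ht
        refine ⟨a :: u', by simpa using h1, fun j hj => ?_, ?_, ?_⟩
        · rw [List.count_cons_of_ne hj.symm, List.count_cons_of_ne hj.symm, h2 j hj]
        · simp; omega
        · simp; omega
    · rw [if_neg hai, List.cons_append, List.prefix_cons_iff] at hu
      rcases hu with rfl | ⟨t, rfl, ht⟩
      · exact ⟨[], by simp⟩
      rw [List.singleton_append, List.prefix_cons_iff] at ht
      rcases ht with rfl | ⟨t, rfl, ht⟩
      · exact ⟨[a], by simp, by simp, by simp [hai], by simp⟩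
      · obtain ⟨u', h1, h2, h3, h4⟩ := ih t ht
        refine ⟨a :: u', by simpa using h1, fun j hj => ?_, ?_, ?_⟩
        · rw [List.count_cons, List.count_cons_of_ne hj.symm, List.count_cons, h2 j hj]
        · rw [List.count_cons_of_ne hai]; simp; omega
        · rw [List.count_cons_of_ne hai]; simp; omega

theorem desubInf_lemma (i : Fin 3) (w u : List (Fin 3)) (hu : u <:+: sigmaSub i w) :
    ∃ u', u' <:+: w ∧ (∀ j, j ≠ i → u.count j = u'.count j) ∧
      u.count i ≤ u'.length + 1 ∧ u'.length ≤ u.count i + 1 := by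
  induction w with
  | nil =>
    have : u = [] := by simpa [sigmaSub] using hu
    subst this
    exact ⟨[], by simp⟩
  | cons a w ih =>
    have key : u <+: sigmaSub i (a :: w) ∨ u <+: i :: sigmaSub i w ∨ u <:+: sigmaSub i w := by
      rw [sigmaSub_cons] at hu ⊢
      by_cases hai : a = i
      · rw [if_pos hai] at *
        rw [List.singleton_append, List.infix_cons_iff] at hu
        rcases hu with hu | hu
        · exact Or.inl hu
        · exact Or.inr (Or.inr hu)
      · rw [if_neg hai] at *
        rw [List.cons_append, List.infix_cons_iff, List.singleton_append,
          List.infix_cons_iff] at hu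
        exact hu
    rcases key with hu | hu | hu
    · obtain ⟨u', h1, h2, h3, h4⟩ := desubPre_lemma i _ u hu
      exact ⟨u', h1.isInfix, h2, by omega, h4⟩
    · rw [List.prefix_cons_iff] at hu
      rcases hu with rfl | ⟨t, rfl, ht⟩
      · exact ⟨[], by simp⟩
      · obtain ⟨u', h1, h2, h3, h4⟩ := desubPre_lemma i _ t ht
        refine ⟨u', h1.isInfix.trans (List.infix_cons (List.infix_refl w)), fun j hj => ?_, ?_, ?_⟩
        · rw [List.count_cons_of_ne hj.symm, h2 j hj]
        · simp; omega
        · simp; omega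
    · obtain ⟨u', h1, h2⟩ := ih hu
      exact ⟨u', h1.trans (List.infix_cons (List.infix_refl w)), h2⟩

theorem ARword_succ (dir : ℕ → Fin 3) (n : ℕ) :
    ARword dir (n + 1) = sigmaSub (dir 0) (ARword (fun k => dir (k + 1)) n) := by
  simp [ARword, List.range_succ_eq_map, Function.comp_def]

theorem ARword_pre_succ (dir : ℕ → Fin 3) (n : ℕ) : ARword dir n <+: ARword dir (n + 1) := by
  induction n generalizing dir with
  | zero =>
    by_cases h : (0 : Fin 3) = dir 0
    · simp [ARword, sigmaSub, ← h]
    · simp [ARword, sigmaSub, h]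
  | succ n ih =>
    obtain ⟨t, ht⟩ := ih (fun k => dir (k + 1))
    rw [ARword_succ dir n, ARword_succ dir (n + 1), ← ht, sigmaSub_append]
    exact List.prefix_append _ _

theorem ARword_pre_le (dir : ℕ → Fin 3) {n m : ℕ} (h : n ≤ m) :
    ARword dir n <+: ARword dir m := by
  induction m, h using Nat.le_induction with
  | base => exact List.prefix_refl _
  | succ m _ ih => exact ih.trans (ARword_pre_succ dir m)

theorem length_eq_sum_count (u : List (Fin 3)) : (u.length : ℤ) = ∑ j, (u.count j : ℤ) := by
  induction u with
  | nil => simp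
  | cons a u ih =>
    rw [Fin.sum_univ_three] at *
    fin_cases a <;> simp <;> omega

theorem AR_main (h : ℕ) (hh : 1 ≤ h) (n : ℕ) (dir : ℕ → Fin 3) (R : Fin 3 → ℕ)
    (u v : List (Fin 3)) (hq : ∀ m : ℕ, ¬ (∀ t ≤ h, dir (m + t) = dir m))
    (hR : ∀ l, R l ≤ h ∧ ¬ (∀ t, t + R l ≤ h → dir t = l))
    (hu : u <:+: ARword dir n) (hv : v <:+: ARword dir n) :
    ¬ ARInv h (fun j => (u.count j : ℤ) - v.count j) R := by
  induction n generalizing dir R u v with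
  | zero =>
    apply ARInv_small h hh
    have hlen : ∀ w : List (Fin 3), w <:+: ARword dir 0 → w.length ≤ 1 := by
      intro w hw
      simpa [ARword] using hw.length_le
    intro j
    have h1 := (List.count_le_length (a := j) (l := u)).trans (hlen u hu)
    have h2 := (List.count_le_length (a := j) (l := v)).trans (hlen v hv)
    constructor <;> omega
  | succ n ih =>
    rw [ARword_succ] at hu hv
    obtain ⟨u', a1, a2, a3, a4⟩ := desubInf_lemma _ _ u hu
    obtain ⟨v', b1, b2, b3, b4⟩ := desubInf_lemma _ _ v hv
    have hRi : R (dir 0) + 1 ≤ h := by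
      obtain ⟨p, q⟩ := hR (dir 0)
      by_contra hcon
      apply q
      intro t ht
      have : t = 0 := by omega
      rw [this]
    intro H
    refine ih (fun k => dir (k + 1)) (fun l => if l = dir 0 then R l + 1 else 0) u' v' ?_ ?_ a1 b1
      (ARInv_step h hh _ _ R _ (dir 0)
        (((u.count (dir 0) : ℤ) - u'.length) - ((v.count (dir 0) : ℤ) - v'.length))
        (by omega) (by omega) ?_ ?_ (fun j => (hR j).1) hRi (by simp) ?_ H)
    · intro m hm
      apply hq (m + 1)
      intro t ht
      have := hm t ht
      rw [← this]
      congr 1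
      omega
    · intro l
      by_cases hl : l = dir 0
      · subst hl
        simp only [if_true]
        refine ⟨hRi, fun hcon => (hR (dir 0)).2 ?_⟩
        intro t ht
        cases t with
        | zero => rfl
        | succ t => exact hcon t (by omega)
      · simp only [if_neg hl]
        refine ⟨by omega, fun hcon => hq 1 ?_⟩
        intro t ht
        have h1 := hcon t (by omega)
        have h2 := hcon 0 (by omega)
        rw [add_comm 1 t, h1, ← h2]
    · intro j hj
      simp only [a2 j hj, b2 j hj]
    · simp only [Finset.sum_sub_distrib, ← length_eq_sum_count]
      ring
    · intro j hj
      simp [hj]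

/-- Theorem 1: if the directive sequence of an Arnoux-Rauzy word `ω` on three
letters never contains `h+1` consecutive equal letters (weak partial quotients
bounded by `h`), then `ω` is `(2h+1)`-balanced. -/
theorem balanced_of_bounded_weak_partial_quotients
    (ω dir : ℕ → Fin 3) (h : ℕ) (hAR : IsAR ω dir)
    (hq : ∀ m : ℕ, ¬ (∀ t ≤ h, dir (m + t) = dir m)) :
    IsBalanced (2 * h + 1) ω := by
  have hh : 1 ≤ h := by
    by_contra hcon
    apply hq 0
    intro t ht
    have : t = 0 := by omega
    rw [this]
  intro u v hu hv huv j
  by_contra hcon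
  obtain ⟨n1, hn1⟩ := (hAR.2 u).1 hu
  obtain ⟨n2, hn2⟩ := (hAR.2 v).1 hv
  refine AR_main h hh (max n1 n2) dir (fun _ => 0) u v hq ?_
    (hn1.trans (ARword_pre_le dir (le_max_left _ _)).isInfix)
    (hn2.trans (ARword_pre_le dir (le_max_right _ _)).isInfix)
    (ARInv_init h hh _ ?_ j ?_)
  · intro l
    refine ⟨Nat.zero_le _, fun hc => hq 0 ?_⟩
    intro t ht
    rw [zero_add, hc t (by omega), hc 0 (by omega)]
  · simp only [Finset.sum_sub_distrib, ← length_eq_sum_count]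
    omega
  · push_cast at hcon
    omega
end

section
/- Let ω be an Arnoux-Rauzy word over A = {1,2,3} with directive sequence (i_m) satisfying: i_{m+2} ∉ {i_m, i_{m+1}} whenever (a) m ≥ 1 and i_{m−1} = i_m ≠ i_{m+1}, or (b) m ≥ 2 and i_{m−2} = i_m ≠ i_{m+1} = i_{m−1}. Then ω is 2-balanced: every pair of equal-length factors u, v of ω satisfies ||u|_j − |v|_j| ≤ 2 for all letters j. -/
/-- Desubstitution of a prefix. -/
theorem desub_prefix (i : Fin 3) (w : List (Fin 3)) : ∀ p : List (Fin 3), p <+: sigmaSub i w →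
    ∃ p' : List (Fin 3), p' <+: w ∧ ∃ e : ℤ, -1 ≤ e ∧ e ≤ 0 ∧
      (p.count i : ℤ) = p'.length + e ∧ ∀ j, j ≠ i → p.count j = p'.count j := by
  induction w with
  | nil =>
    intro p hp
    have : p = [] := by simpa [sigmaSub] using hp
    subst this
    exact ⟨[], by simp, 0, by simp⟩
  | cons x w ih =>
    intro p hp
    have hcons : sigmaSub i (x :: w) = (if x = i then [i] else [x, i]) ++ sigmaSub i w := by
      simp [sigmaSub]
    rw [hcons] at hp
    by_cases hx : x = i
    · subst hx
      simp only [if_true, List.singleton_append] at hp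
      rcases List.prefix_cons_iff.1 hp with rfl | ⟨t, rfl, ht⟩
      · exact ⟨[], by simp, 0, by simp⟩
      · obtain ⟨t', h1, e, h2, h3, h4, h5⟩ := ih t ht
        refine ⟨x :: t', by simpa using h1, e, h2, h3, ?_, ?_⟩
        · simp; omega
        · intro j hj
          have := h5 j hj
          simp [List.count_cons, this]
    · simp only [if_neg hx, List.cons_append, List.nil_append] at hp
      rcases List.prefix_cons_iff.1 hp with rfl | ⟨t, rfl, ht⟩
      · exact ⟨[], by simp, 0, by simp⟩
      rcases List.prefix_cons_iff.1 ht with rfl | ⟨t, rfl, ht2⟩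
      · refine ⟨[x], by simp, -1, by simp, by simp, by simp [hx], by simp⟩
      · obtain ⟨t', h1, e, h2, h3, h4, h5⟩ := ih t ht2
        refine ⟨x :: t', by simpa using h1, e, h2, h3, ?_, ?_⟩
        · simp [List.count_cons, hx]; omega
        · intro j hj
          have := h5 j hj
          simp [List.count_cons, this, Ne.symm hj]

/-- Desubstitution of a factor. -/
theorem desub_infix (i : Fin 3) (w : List (Fin 3)) : ∀ p : List (Fin 3), p <:+: sigmaSub i w →
    ∃ p' : List (Fin 3), p' <:+: w ∧ ∃ e : ℤ, -1 ≤ e ∧ e ≤ 1 ∧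
      (p.count i : ℤ) = p'.length + e ∧ ∀ j, j ≠ i → p.count j = p'.count j := by
  have key : ∀ (w p : List (Fin 3)), p <+: sigmaSub i w →
    ∃ p' : List (Fin 3), p' <:+: w ∧ ∃ e : ℤ, -1 ≤ e ∧ e ≤ 1 ∧
      (p.count i : ℤ) = p'.length + e ∧ ∀ j, j ≠ i → p.count j = p'.count j := by
    intro w p hp
    obtain ⟨t', h1, e, h2, h3, h4, h5⟩ := desub_prefix i w p hp
    exact ⟨t', h1.isInfix, e, h2, by omega, h4, h5⟩
  induction w with
  | nil =>
    intro p hp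
    have : p = [] := by simpa [sigmaSub] using hp
    subst this
    exact ⟨[], by simp, 0, by simp⟩
  | cons x w ih =>
    intro p hp
    have hcons : sigmaSub i (x :: w) = (if x = i then [i] else [x, i]) ++ sigmaSub i w := by
      simp [sigmaSub]
    have lift : p <:+: sigmaSub i w → ∃ p' : List (Fin 3), p' <:+: x :: w ∧ ∃ e : ℤ,
        -1 ≤ e ∧ e ≤ 1 ∧
      (p.count i : ℤ) = p'.length + e ∧ ∀ j, j ≠ i → p.count j = p'.count j := by
      intro h
      obtain ⟨t', h1, h2⟩ := ih p h
      exact ⟨t', List.infix_cons h1, h2⟩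
    by_cases hx : x = i
    · have hp0 := hp
      rw [hcons, if_pos hx, List.singleton_append] at hp
      rcases List.infix_cons_iff.1 hp with h | h
      · refine key _ _ ?_
        rw [hcons, if_pos hx]; exact h
      · exact lift h
    · rw [hcons, if_neg hx] at hp
      simp only [List.cons_append, List.nil_append] at hp
      rcases List.infix_cons_iff.1 hp with h | h
      · refine key _ _ ?_
        rw [hcons, if_neg hx]; exact h
      rcases List.infix_cons_iff.1 h with h | h
      · rcases List.prefix_cons_iff.1 h with rfl | ⟨t, rfl, ht⟩
        · exact ⟨[], by simp, 0, by simp⟩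
        · obtain ⟨t', h1, e, h2, h3, h4, h5⟩ := desub_prefix i w t ht
          refine ⟨t', List.infix_cons h1.isInfix, e + 1, by omega, by omega, ?_, ?_⟩
          · simp; omega
          · intro j hj
            simp [List.count_cons, h5 j hj, Ne.symm hj]
      · exact lift h

/-- The finite word of depth `k` for the directive sequence shifted by `p`. -/
def levelWord (dir : ℕ → Fin 3) (p k : ℕ) : List (Fin 3) := ARword (fun m => dir (p + m)) k

theorem levelWord_succ (dir : ℕ → Fin 3) (p k : ℕ) :
    levelWord dir p (k + 1) = sigmaSub (dir p) (levelWord dir (p + 1) k) := by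
  unfold levelWord ARword
  rw [List.range_succ_eq_map]
  have : ∀ x, p + 1 + x = p + (x + 1) := fun x => by omega
  simp [Function.comp_def, this]

theorem levelWord_prefix (dir : ℕ → Fin 3) (k : ℕ) : ∀ p,
    levelWord dir p k <+: levelWord dir p (k + 1) := by
  induction k with
  | zero =>
    intro p
    rw [levelWord_succ]
    simp only [levelWord, ARword, sigmaSub, List.range_zero, List.map_nil, List.foldr_nil,
      List.flatMap_cons, List.flatMap_nil, List.append_nil]
    split_ifs with h
    · rw [← h]
    · exact ⟨[dir p], rfl⟩
  | succ k ih =>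
    intro p
    rw [levelWord_succ, levelWord_succ dir p (k + 1)]
    obtain ⟨t, ht⟩ := ih (p + 1)
    rw [← ht]
    exact ⟨sigmaSub (dir p) t, by simp [sigmaSub]⟩

theorem levelWord_mono (dir : ℕ → Fin 3) (p k l : ℕ) (h : k ≤ l) :
    levelWord dir p k <+: levelWord dir p l := by
  induction l, h using Nat.le_induction with
  | base => exact List.prefix_rfl
  | succ l _ ih => exact ih.trans (levelWord_prefix dir l p)

/-- `a, b, c` are the three letters in some order. -/
def Letters (a b c : Fin 3) : Prop := a ≠ b ∧ a ≠ c ∧ b ≠ c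

theorem Letters.length_eq {a b c : Fin 3} (h : Letters a b c) (u : List (Fin 3)) :
    u.length = u.count a + u.count b + u.count c := by
  obtain ⟨h1, h2, h3⟩ := h
  induction u with
  | nil => rfl
  | cons x u ih =>
    have hx : x = a ∨ x = b ∨ x = c := by
      revert h1 h2 h3; clear ih; revert a b c x; decide
    rcases hx with rfl | rfl | rfl <;>
      simp [List.count_cons, h1, h2, h3, h1.symm, h2.symm, h3.symm, ih] <;> omega

theorem Letters.cases {a b c : Fin 3} (h : Letters a b c) (x : Fin 3) :
    x = a ∨ x = b ∨ x = c := by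
  obtain ⟨h1, h2, h3⟩ := h
  revert a b c x; decide

/-- Some pair of factors at level `p`, depth `k` has difference vector `(α, β, γ)`. -/
def Diff (dir : ℕ → Fin 3) (p k : ℕ) (a b c : Fin 3) (α β γ : ℤ) : Prop :=
  ∃ u v : List (Fin 3), u <:+: levelWord dir p k ∧ v <:+: levelWord dir p k ∧
    α = u.count a - v.count a ∧ β = u.count b - v.count b ∧ γ = u.count c - v.count c

theorem Diff.rot {dir p k a b c α β γ} (h : Diff dir p k a b c α β γ) :
    Diff dir p k b c a β γ α := by
  obtain ⟨u, v, hu, hv, h1, h2, h3⟩ := h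
  exact ⟨u, v, hu, hv, h2, h3, h1⟩

theorem Diff.neg {dir p k a b c α β γ} (h : Diff dir p k a b c α β γ) :
    Diff dir p k a b c (-α) (-β) (-γ) := by
  obtain ⟨u, v, hu, hv, h1, h2, h3⟩ := h
  exact ⟨v, u, hv, hu, by omega, by omega, by omega⟩

theorem Diff.zero {dir p a b c α β γ} (h : Diff dir p 0 a b c α β γ) : -1 ≤ γ := by
  obtain ⟨u, v, hu, hv, h1, h2, h3⟩ := h
  have h4 : v.length ≤ 1 := by
    have := hv.length_le
    simpa [levelWord, ARword] using this
  have h5 : v.count c ≤ v.length := List.count_le_length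
  omega

theorem Diff.step {dir p k a b c α β γ} (hl : Letters a b c)
    (h : Diff dir p (k + 1) a b c α β γ) (hd : dir p = a) :
    ∃ ε : ℤ, -2 ≤ ε ∧ ε ≤ 2 ∧ Diff dir (p + 1) k a b c (α - β - γ + ε) β γ := by
  obtain ⟨u, v, hu, hv, h1, h2, h3⟩ := h
  rw [levelWord_succ, hd] at hu hv
  obtain ⟨u', hu', e, e1, e2, e3, e4⟩ := desub_infix _ _ _ hu
  obtain ⟨v', hv', f, f1, f2, f3, f4⟩ := desub_infix _ _ _ hv
  have hb := hl.1.symm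
  have hc := hl.2.1.symm
  have l1 := hl.length_eq u'
  have l2 := hl.length_eq v'
  refine ⟨f - e, by omega, by omega, u', v', hu', hv', ?_, ?_, ?_⟩
  · rw [e4 b hb, f4 b hb] at *
    rw [e4 c hc, f4 c hc] at *
    omega
  · rw [h2, e4 b hb, f4 b hb]
  · rw [h3, e4 c hc, f4 c hc]

/-- 2-balance at level `p`, depth `k`. -/
def Bal (dir : ℕ → Fin 3) (p k : ℕ) : Prop :=
  ∀ u v : List (Fin 3), u <:+: levelWord dir p k → v <:+: levelWord dir p k →
    u.length = v.length → ∀ j, u.count j ≤ v.count j + 2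

theorem Bal.diff {dir p k a b c α β γ} (hB : Bal dir p k) (hl : Letters a b c)
    (h : Diff dir p k a b c α β γ) (hs : 0 ≤ α + β + γ) :
    -2 ≤ α ∧ α ≤ 2 + (α + β + γ) := by
  obtain ⟨u, v, hu, hv, h1, h2, h3⟩ := h
  have l1 := hl.length_eq u
  have l2 := hl.length_eq v
  have hle : v.length ≤ u.length := by omega
  have ht : (u.take v.length).length = v.length := by simp [hle]
  have hi : u.take v.length <:+: levelWord dir p k := (List.take_prefix _ _).isInfix.trans hu
  have b1 := hB _ _ hi hv ht a
  have b2 := hB _ _ hv hi ht.symm a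
  have hsplit : u.count a = (u.take v.length).count a + (u.drop v.length).count a := by
    rw [← List.count_append, List.take_append_drop]
  have hdl : (u.drop v.length).count a ≤ (u.drop v.length).length := List.count_le_length
  rw [List.length_drop] at hdl
  omega

section chain

variable {dir : ℕ → Fin 3} {a b c : Fin 3}

/-- Letter `c` cannot be applied to these states. -/
theorem dead_c {p k : ℕ} {α β : ℤ} (hl : Letters a b c) (hB : Bal dir (p + 1) k)
    (h : Diff dir p (k + 1) a b c α β (-2)) (hd : dir p = c)
    (hs : 3 ≤ α ∨ 3 ≤ α + β) : False := by
  have hl' : Letters c a b := ⟨hl.2.1.symm, hl.2.2.symm, hl.1⟩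
  have hla : Letters a b c := hl
  obtain ⟨ε, e1, e2, h'⟩ := h.rot.rot.step hl' hd
  have hn := h'.neg
  have x1 := hB.diff hl' hn (by omega)
  have x2 := hB.diff hla hn.rot (by omega)
  omega

theorem state_B {p k : ℕ} {α β : ℤ} (hl : Letters a b c) (hB : ∀ m ≤ k, ∀ q, Bal dir q m)
    (h : Diff dir p k a b c α β (-2)) (hd : dir p = c)
    (hs : 3 ≤ α ∨ 3 ≤ α + β) : False := by
  cases k with
  | zero => have := h.zero; omega
  | succ k => exact dead_c hl (hB k (by omega) _) h hd hs

theorem step_b {p k : ℕ} {α β : ℤ} (hl : Letters a b c)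
    (h : Diff dir p (k + 1) a b c α β (-2)) (hd : dir p = b) :
    ∃ β', Diff dir (p + 1) k a b c α β' (-2) := by
  have hl' : Letters b c a := ⟨hl.2.2, hl.1.symm, hl.2.1.symm⟩
  obtain ⟨ε, e1, e2, h'⟩ := h.rot.step hl' hd
  exact ⟨_, h'.rot.rot⟩

theorem chain_bb (h1 : ∀ m : ℕ, dir m = dir (m + 1) → dir (m + 1) ≠ dir (m + 2) →
      dir (m + 3) ≠ dir (m + 1) ∧ dir (m + 3) ≠ dir (m + 2))
    (hl : Letters a b c) : ∀ (k p : ℕ) (α β : ℤ), (∀ m ≤ k, ∀ q, Bal dir q m) →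
    dir p = b → dir (p + 1) = b → 3 ≤ α → Diff dir (p + 2) k a b c α β (-2) → False := by
  intro k
  induction k with
  | zero => intro p α β _ _ _ _ h; have := h.zero; omega
  | succ k ih =>
    intro p α β hB d0 d1 hα h
    rcases hl.cases (dir (p + 2)) with d2 | d2 | d2
    · obtain ⟨ε, e1, e2, h'⟩ := h.step hl d2
      have hc := h1 p (by rw [d0, d1]) (by rw [d1, d2]; exact hl.1.symm)
      rw [d1, d2] at hc
      have d3 : dir (p + 3) = c := by
        rcases hl.cases (dir (p + 3)) with d3 | d3 | d3 <;> simp_all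
      exact state_B hl (fun m hm => hB m (by omega)) h' d3 (by omega)
    · obtain ⟨β', h'⟩ := step_b hl h d2
      exact ih (p + 1) α β' (fun m hm => hB m (by omega)) d1 d2 hα h'
    · exact state_B hl hB h d2 (by omega)

theorem chain_bab (h1 : ∀ m : ℕ, dir m = dir (m + 1) → dir (m + 1) ≠ dir (m + 2) →
      dir (m + 3) ≠ dir (m + 1) ∧ dir (m + 3) ≠ dir (m + 2))
    (h2 : ∀ m : ℕ, dir m = dir (m + 2) → dir (m + 2) ≠ dir (m + 3) →
      dir (m + 3) = dir (m + 1) →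
      dir (m + 4) ≠ dir (m + 2) ∧ dir (m + 4) ≠ dir (m + 3))
    (hl : Letters a b c) (k p : ℕ) (α β : ℤ) (hB : ∀ m ≤ k, ∀ q, Bal dir q m)
    (d0 : dir p = b) (d1 : dir (p + 1) = a) (d2 : dir (p + 2) = b) (hα : 3 ≤ α)
    (h : Diff dir (p + 3) k a b c α β (-2)) : False := by
  cases k with
  | zero => have := h.zero; omega
  | succ k =>
    rcases hl.cases (dir (p + 3)) with d3 | d3 | d3
    · obtain ⟨ε, e1, e2, h'⟩ := h.step hl d3
      have hc := h2 p (by rw [d0, d2]) (by rw [d2, d3]; exact hl.1.symm) (by rw [d3, d1])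
      rw [d2, d3] at hc
      have d4 : dir (p + 4) = c := by
        rcases hl.cases (dir (p + 4)) with d4 | d4 | d4 <;> simp_all
      exact state_B hl (fun m hm => hB m (by omega)) h' d4 (by omega)
    · obtain ⟨β', h'⟩ := step_b hl h d3
      exact chain_bb h1 hl k (p + 2) α β' (fun m hm => hB m (by omega)) d2 d3 hα h'
    · exact state_B hl hB h d3 (by omega)

theorem chain_aa (h1 : ∀ m : ℕ, dir m = dir (m + 1) → dir (m + 1) ≠ dir (m + 2) →
      dir (m + 3) ≠ dir (m + 1) ∧ dir (m + 3) ≠ dir (m + 2))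
    (hl : Letters a b c) : ∀ (k p : ℕ) (α : ℤ), (∀ m ≤ k, ∀ q, Bal dir q m) →
    dir p = a → dir (p + 1) = a → 3 ≤ α → Diff dir (p + 2) k a b c α 0 (-2) → False := by
  intro k
  induction k with
  | zero => intro p α _ _ _ _ h; have := h.zero; omega
  | succ k ih =>
    intro p α hB d0 d1 hα h
    rcases hl.cases (dir (p + 2)) with d2 | d2 | d2
    · obtain ⟨ε, e1, e2, h'⟩ := h.step hl d2
      exact ih (p + 1) _ (fun m hm => hB m (by omega)) d1 d2 (by omega) h'
    · obtain ⟨β', h'⟩ := step_b hl h d2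
      have hc := h1 p (by rw [d0, d1]) (by rw [d1, d2]; exact hl.1)
      rw [d1, d2] at hc
      have d3 : dir (p + 3) = c := by
        rcases hl.cases (dir (p + 3)) with d3 | d3 | d3 <;> simp_all
      exact state_B hl (fun m hm => hB m (by omega)) h' d3 (by omega)
    · exact state_B hl hB h d2 (by omega)

theorem chain_ba (h1 : ∀ m : ℕ, dir m = dir (m + 1) → dir (m + 1) ≠ dir (m + 2) →
      dir (m + 3) ≠ dir (m + 1) ∧ dir (m + 3) ≠ dir (m + 2))
    (h2 : ∀ m : ℕ, dir m = dir (m + 2) → dir (m + 2) ≠ dir (m + 3) →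
      dir (m + 3) = dir (m + 1) →
      dir (m + 4) ≠ dir (m + 2) ∧ dir (m + 4) ≠ dir (m + 3))
    (hl : Letters a b c) (k p : ℕ) (α : ℤ) (hB : ∀ m ≤ k, ∀ q, Bal dir q m)
    (d0 : dir p = b) (d1 : dir (p + 1) = a) (hα : 3 ≤ α)
    (h : Diff dir (p + 2) k a b c α 0 (-2)) : False := by
  cases k with
  | zero => have := h.zero; omega
  | succ k =>
    rcases hl.cases (dir (p + 2)) with d2 | d2 | d2
    · obtain ⟨ε, e1, e2, h'⟩ := h.step hl d2
      exact chain_aa h1 hl k (p + 1) _ (fun m hm => hB m (by omega)) d1 d2 (by omega) h'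
    · obtain ⟨β', h'⟩ := step_b hl h d2
      exact chain_bab h1 h2 hl k p α β' (fun m hm => hB m (by omega)) d0 d1 d2 hα h'
    · exact state_B hl hB h d2 (by omega)

theorem chain_b (h1 : ∀ m : ℕ, dir m = dir (m + 1) → dir (m + 1) ≠ dir (m + 2) →
      dir (m + 3) ≠ dir (m + 1) ∧ dir (m + 3) ≠ dir (m + 2))
    (h2 : ∀ m : ℕ, dir m = dir (m + 2) → dir (m + 2) ≠ dir (m + 3) →
      dir (m + 3) = dir (m + 1) →
      dir (m + 4) ≠ dir (m + 2) ∧ dir (m + 4) ≠ dir (m + 3))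
    (hl : Letters a b c) (k p : ℕ) (α : ℤ) (hB : ∀ m ≤ k, ∀ q, Bal dir q m)
    (d0 : dir p = b) (hα : 3 ≤ α)
    (h : Diff dir (p + 1) k a b c α 0 (-2)) : False := by
  cases k with
  | zero => have := h.zero; omega
  | succ k =>
    rcases hl.cases (dir (p + 1)) with d1 | d1 | d1
    · obtain ⟨ε, e1, e2, h'⟩ := h.step hl d1
      exact chain_ba h1 h2 hl k p _ (fun m hm => hB m (by omega)) d0 d1 (by omega) h'
    · obtain ⟨β', h'⟩ := step_b hl h d1
      exact chain_bb h1 hl k p α β' (fun m hm => hB m (by omega)) d0 d1 hα h'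
    · exact state_B hl hB h d1 (by omega)

/-- An imbalance of three is impossible when the first directive letter is `b ≠ a`. -/
theorem first_b (h1 : ∀ m : ℕ, dir m = dir (m + 1) → dir (m + 1) ≠ dir (m + 2) →
      dir (m + 3) ≠ dir (m + 1) ∧ dir (m + 3) ≠ dir (m + 2))
    (h2 : ∀ m : ℕ, dir m = dir (m + 2) → dir (m + 2) ≠ dir (m + 3) →
      dir (m + 3) = dir (m + 1) →
      dir (m + 4) ≠ dir (m + 2) ∧ dir (m + 4) ≠ dir (m + 3))
    (hl : Letters a b c) (k p : ℕ) (α β γ : ℤ) (hB : ∀ m ≤ k, ∀ q, Bal dir q m)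
    (d0 : dir p = b) (hα : 3 ≤ α) (hs : α + β + γ = 0)
    (h : Diff dir p (k + 1) a b c α β γ) : False := by
  have hl' : Letters b c a := ⟨hl.2.2, hl.1.symm, hl.2.1.symm⟩
  have hl'' : Letters c a b := ⟨hl.2.1.symm, hl.2.2.symm, hl.1⟩
  obtain ⟨ε, e1, e2, h'⟩ := h.rot.step hl' d0
  have hb := hB k le_rfl (p + 1)
  rcases le_or_gt (β - γ - α + ε + γ + α) 0 with hneg | hpos
  · have := hb.diff hl h'.rot.rot.neg (by omega)
    omega
  · have x1 := hb.diff hl h'.rot.rot (by omega)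
    have x2 := hb.diff hl'' h'.rot (by omega)
    have y1 : β - γ - α + ε = 0 := by omega
    have y2 : γ = -2 := by omega
    rw [y1, y2] at h'
    exact chain_b h1 h2 hl k p α hB d0 hα h'.rot.rot

theorem bal_all (h1 : ∀ m : ℕ, dir m = dir (m + 1) → dir (m + 1) ≠ dir (m + 2) →
      dir (m + 3) ≠ dir (m + 1) ∧ dir (m + 3) ≠ dir (m + 2))
    (h2 : ∀ m : ℕ, dir m = dir (m + 2) → dir (m + 2) ≠ dir (m + 3) →
      dir (m + 3) = dir (m + 1) →
      dir (m + 4) ≠ dir (m + 2) ∧ dir (m + 4) ≠ dir (m + 3)) :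
    ∀ (k p : ℕ), Bal dir p k := by
  intro k
  induction k using Nat.strong_induction_on with
  | _ k ih =>
    intro p u v hu hv huv a
    by_contra hcon
    cases k with
    | zero =>
      have h4 : u.length ≤ 1 := by
        have := hu.length_le
        simpa [levelWord, ARword] using this
      have h5 : u.count a ≤ u.length := List.count_le_length
      omega
    | succ k =>
      have hB : ∀ m ≤ k, ∀ q, Bal dir q m := fun m hm => ih m (by omega)
      have main : ∀ b c, Letters a b c → dir p = a ∨ dir p = b → False := by
        intro b c hl hd
        have l1 := hl.length_eq u
        have l2 := hl.length_eq v
        have h : Diff dir p (k + 1) a b c _ _ _ := ⟨u, v, hu, hv, rfl, rfl, rfl⟩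
        rcases hd with hd | hd
        · obtain ⟨ε, e1, e2, h'⟩ := h.step hl hd
          have := (hB k le_rfl (p + 1)).diff hl h' (by omega)
          omega
        · exact first_b h1 h2 hl k p _ _ _ hB hd (by omega) (by omega) h
      have hex : ∀ a x : Fin 3, ∃ b c : Fin 3, (a ≠ b ∧ a ≠ c ∧ b ≠ c) ∧ (x = a ∨ x = b) := by
        decide
      obtain ⟨b, c, hl, hd⟩ := hex a (dir p)
      exact main b c hl hd

end chain

/-- Theorem 2: if the directive sequence `(i_m)` of an Arnoux-Rauzy word `ω`
satisfies `i_{m+2} ∉ {i_m, i_{m+1}}` whenever (a) `i_{m-1} = i_m ≠ i_{m+1}`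
(`m ≥ 1`), or (b) `i_{m-2} = i_m ≠ i_{m+1} = i_{m-1}` (`m ≥ 2`),
then `ω` is `2`-balanced. (Both conditions are stated with shifted indices.) -/
theorem two_balanced_of_directive_conditions
    (ω dir : ℕ → Fin 3) (hAR : IsAR ω dir)
    (h1 : ∀ m : ℕ, dir m = dir (m + 1) → dir (m + 1) ≠ dir (m + 2) →
      dir (m + 3) ≠ dir (m + 1) ∧ dir (m + 3) ≠ dir (m + 2))
    (h2 : ∀ m : ℕ, dir m = dir (m + 2) → dir (m + 2) ≠ dir (m + 3) →
      dir (m + 3) = dir (m + 1) →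
      dir (m + 4) ≠ dir (m + 2) ∧ dir (m + 4) ≠ dir (m + 3)) :
    IsBalanced 2 ω := by
  have hw : ∀ n, ARword dir n = levelWord dir 0 n := by
    intro n; simp [levelWord]
  have key : ∀ u v : List (Fin 3), FactorOf ω u → FactorOf ω v → u.length = v.length →
      ∀ j, u.count j ≤ v.count j + 2 := by
    intro u v hu hv huv j
    obtain ⟨n, hn⟩ := (hAR.2 u).1 hu
    obtain ⟨m, hm⟩ := (hAR.2 v).1 hv
    rw [hw] at hn hm
    exact bal_all h1 h2 (max n m) 0 u v
      (hn.trans (levelWord_mono dir 0 n _ (le_max_left _ _)).isInfix)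
      (hm.trans (levelWord_mono dir 0 m _ (le_max_right _ _)).isInfix) huv j
  intro u v hu hv huv j
  have k1 := key u v hu hv huv j
  have k2 := key v u hv hu huv.symm j
  rw [abs_le]
  constructor <;> push_cast <;> omega
end
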